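/- Let P = P(M_•) be an MV polytope for a simply-laced simple Lie algebra g, Z = Pol^{−1}(P) the corresponding irreducible component of Lusztig's nilpotent variety, and T a general point of Z. Then for any j ∈ I, c_j(P) := M_{ϖ_j} − M_{s_jϖ_j} − 1 equals φ_j(Z) − 1, where φ_j(Z) = ε_j(Z) + ⟨h_j, wt(Z)⟩, ε_j(Z) = dim top_j(T) generically, and wt(Z) = −dim T. -/

import Mathlib

noncomputable section
open Module

/-! The preprojective algebra `Λ = Λ(Q)` of a quiver `Q` whose underlying graph is a
(simply-laced) Dynkin diagram with Cartan matrix `C`, constructed as the quotient of the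
path algebra of the double quiver `Q̄` (realized inside the free algebra on the vertex
idempotents and the arrows) by the preprojective relations `∑_a ε(a) a a* = 0`.
`sgn i j` is the sign `ε` of the arrow `i → j` of `Q̄` (`+1` on `Ω`, `−1` on `Ω*`). -/

/-- Generators of the path algebra of the double quiver: one idempotent per vertex and
one arrow `i → j` for every pair of adjacent vertices `i, j`. -/
inductive PGen (I : Type) : Type
  | idem : I → PGen I
  | arrow : I → I → PGen I

variable {I : Type} [Fintype I] [DecidableEq I]

open PGen in
/-- The defining relations of the preprojective algebra: the path-algebra relations for
the idempotents and arrows of the double quiver of the graph of `C` (the generator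
`arrow i j` is set to `0` when `i` and `j` are not adjacent), and the preprojective
relations `∑_{a : t(a) = i} ε(a) a a* = 0`. -/
inductive PRel (C : I → I → ℤ) (sgn : I → I → ℤ) :
    FreeAlgebra ℂ (PGen I) → FreeAlgebra ℂ (PGen I) → Prop
  | idem_mul (i j : I) :
      PRel C sgn (FreeAlgebra.ι ℂ (idem i) * FreeAlgebra.ι ℂ (idem j))
        (if i = j then FreeAlgebra.ι ℂ (idem i) else 0)
  | idem_sum : PRel C sgn (∑ i : I, FreeAlgebra.ι ℂ (idem i)) 1
  | arrow_src (i j : I) :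
      PRel C sgn (FreeAlgebra.ι ℂ (arrow i j) * FreeAlgebra.ι ℂ (idem i))
        (FreeAlgebra.ι ℂ (arrow i j))
  | arrow_tgt (i j : I) :
      PRel C sgn (FreeAlgebra.ι ℂ (idem j) * FreeAlgebra.ι ℂ (arrow i j))
        (FreeAlgebra.ι ℂ (arrow i j))
  | arrow_zero (i j : I) (h : C i j ≠ -1) :
      PRel C sgn (FreeAlgebra.ι ℂ (arrow i j)) 0
  | preproj (i : I) :
      PRel C sgn
        (∑ j : I, sgn j i • (FreeAlgebra.ι ℂ (arrow j i) * FreeAlgebra.ι ℂ (arrow i j))) 0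

/-- The preprojective algebra of the graph of `C` (with signs `sgn`). -/
def PreprojAlg (C : I → I → ℤ) (sgn : I → I → ℤ) : Type := RingQuot (PRel C sgn)

instance (C sgn : I → I → ℤ) : Ring (PreprojAlg C sgn) :=
  inferInstanceAs (Ring (RingQuot (PRel C sgn)))
instance (C sgn : I → I → ℤ) : Algebra ℂ (PreprojAlg C sgn) :=
  inferInstanceAs (Algebra ℂ (RingQuot (PRel C sgn)))

/-- The vertex idempotent `e_i ∈ Λ`. -/
def pe (C sgn : I → I → ℤ) (i : I) : PreprojAlg C sgn :=
  RingQuot.mkRingHom (PRel C sgn) (FreeAlgebra.ι ℂ (PGen.idem i))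

/-- The ℂ-linear action of the idempotent `e_i` on a `Λ`-module `X`. -/
def smulIdem (C sgn : I → I → ℤ) (X : Type) [AddCommGroup X] [Module ℂ X]
    [Module (PreprojAlg C sgn) X] [SMulCommClass (PreprojAlg C sgn) ℂ X] (i : I) :
    X →ₗ[ℂ] X where
  toFun x := pe C sgn i • x
  map_add' x y := smul_add _ x y
  map_smul' c x := smul_comm _ c x

/-- The dimension vector of a `Λ`-module `X`: `(dim X)_i = dim_ℂ (e_i X)`. -/
def dimv (C sgn : I → I → ℤ) (X : Type) [AddCommGroup X] [Module ℂ X]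
    [Module (PreprojAlg C sgn) X] [SMulCommClass (PreprojAlg C sgn) ℂ X] (i : I) : ℕ :=
  finrank ℂ (LinearMap.range (smulIdem C sgn X i))

/-- Composition with `ι` as a ℂ-linear map between `Λ`-homomorphism spaces. -/
def precomp {Λ : Type} [Ring Λ] {K P M : Type}
    [AddCommGroup K] [Module Λ K] [AddCommGroup P] [Module Λ P]
    [AddCommGroup M] [Module Λ M] [Module ℂ M] [SMulCommClass Λ ℂ M]
    (ι : K →ₗ[Λ] P) : (P →ₗ[Λ] M) →ₗ[ℂ] (K →ₗ[Λ] M) where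
  toFun g := g.comp ι
  map_add' g h := by ext x; simp
  map_smul' c g := by ext x; simp

/-- `dim Ext¹_Λ(C, M)` computed from a projective presentation `0 → K → P → C → 0` of
`C`: the dimension of the cokernel of `Hom_Λ(P,M) → Hom_Λ(K,M)`. -/
def ext1dim {Λ : Type} [Ring Λ] {K P : Type}
    [AddCommGroup K] [Module Λ K] [AddCommGroup P] [Module Λ P]
    (ι : K →ₗ[Λ] P) (M : Type)
    [AddCommGroup M] [Module Λ M] [Module ℂ M] [SMulCommClass Λ ℂ M] : ℕ :=
  finrank ℂ ((K →ₗ[Λ] M) ⧸ LinearMap.range (precomp (M := M) ι))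

/-- The class of the arrow `i → k` in `Λ`. -/
def pa (C sgn : I → I → ℤ) (i k : I) : PreprojAlg C sgn :=
  RingQuot.mkRingHom (PRel C sgn) (FreeAlgebra.ι ℂ (PGen.arrow i k))

section Relations

variable (C sgn : I → I → ℤ)

theorem pe_mul_pe (i k : I) : pe C sgn i * pe C sgn k = if i = k then pe C sgn i else 0 := by
  have h := RingQuot.mkRingHom_rel (PRel.idem_mul (C := C) (sgn := sgn) i k)
  rw [map_mul, apply_ite (RingQuot.mkRingHom (PRel C sgn)), map_zero] at h
  exact h

theorem pa_mul_pe (i k : I) : pa C sgn i k * pe C sgn i = pa C sgn i k := by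
  have h := RingQuot.mkRingHom_rel (PRel.arrow_src (C := C) (sgn := sgn) i k)
  rw [map_mul] at h
  exact h

theorem pe_mul_pa (i k : I) : pe C sgn k * pa C sgn i k = pa C sgn i k := by
  have h := RingQuot.mkRingHom_rel (PRel.arrow_tgt (C := C) (sgn := sgn) i k)
  rw [map_mul] at h
  exact h

theorem pa_eq_zero {i k : I} (hik : C i k ≠ -1) : pa C sgn i k = 0 := by
  have h := RingQuot.mkRingHom_rel (PRel.arrow_zero (C := C) (sgn := sgn) i k hik)
  rw [map_zero] at h
  exact h

theorem sum_pa_mul_pa (i : I) : ∑ k : I, sgn k i • (pa C sgn k i * pa C sgn i k) = 0 := by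
  have h := RingQuot.mkRingHom_rel (PRel.preproj (C := C) (sgn := sgn) i)
  simp only [map_sum, map_zsmul, map_mul, map_zero] at h
  exact h

theorem sum_pe : ∑ i : I, pe C sgn i = 1 := by
  have h := RingQuot.mkRingHom_rel (PRel.idem_sum (C := C) (sgn := sgn))
  simp only [map_sum, map_one] at h
  exact h

/-- The vertex idempotents and the arrows generate `Λ` as an algebra. -/
theorem preprojAlg_induction {p : PreprojAlg C sgn → Prop}
    (hc : ∀ c : ℂ, p (algebraMap ℂ _ c)) (he : ∀ i, p (pe C sgn i))
    (ha : ∀ i k, p (pa C sgn i k)) (hadd : ∀ x y, p x → p y → p (x + y))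
    (hmul : ∀ x y, p x → p y → p (x * y)) (x : PreprojAlg C sgn) : p x := by
  obtain ⟨y, rfl⟩ := RingQuot.mkAlgHom_surjective ℂ (PRel C sgn) x
  have hcoe (z : FreeAlgebra ℂ (PGen I)) : RingQuot.mkAlgHom ℂ (PRel C sgn) z =
      RingQuot.mkRingHom (PRel C sgn) z := by
    rw [← RingQuot.mkAlgHom_coe ℂ]; rfl
  induction y using FreeAlgebra.induction with
  | grade0 r =>
    rw [AlgHom.commutes]
    exact hc r
  | grade1 g =>
    rw [hcoe]
    cases g with
    | idem i => exact he i
    | arrow i k => exact ha i k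
  | mul a b ha hb =>
    rw [map_mul]
    exact hmul _ _ ha hb
  | add a b ha hb =>
    rw [map_add]
    exact hadd _ _ ha hb

/-- A representation of the double quiver satisfying the preprojective relations extends to
a representation of `Λ`. -/
theorem exists_algHom_preprojAlg {E : Type} [AddCommGroup E] [Module ℂ E]
    (e : I → End ℂ E) (a : I → I → End ℂ E)
    (hee : ∀ i k, e i * e k = if i = k then e i else 0) (hsum : ∑ i, e i = 1)
    (hae : ∀ i k, a i k * e i = a i k) (hea : ∀ i k, e k * a i k = a i k)
    (ha0 : ∀ i k, C i k ≠ -1 → a i k = 0)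
    (hpre : ∀ i, ∑ k, sgn k i • (a k i * a i k) = 0) :
    ∃ ρ : PreprojAlg C sgn →ₐ[ℂ] End ℂ E,
      (∀ i, ρ (pe C sgn i) = e i) ∧ ∀ i k, ρ (pa C sgn i k) = a i k := by
  let f : FreeAlgebra ℂ (PGen I) →ₐ[ℂ] End ℂ E :=
    FreeAlgebra.lift ℂ fun g => match g with
      | PGen.idem i => e i
      | PGen.arrow i k => a i k
  have fe (i : I) : f (FreeAlgebra.ι ℂ (PGen.idem i)) = e i := by simp [f]
  have fa (i k : I) : f (FreeAlgebra.ι ℂ (PGen.arrow i k)) = a i k := by simp [f]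
  have hf : ∀ ⦃x y⦄, PRel C sgn x y → f x = f y := by
    intro x y h
    cases h with
    | idem_mul i k =>
      rw [map_mul, apply_ite f, map_zero, fe, fe, hee]
    | idem_sum => simp [fe, hsum]
    | arrow_src i k => simp [fe, fa, hae]
    | arrow_tgt i k => simp [fe, fa, hea]
    | arrow_zero i k h => simp [fa, ha0 i k h]
    | preproj i => simp only [map_sum, map_zsmul, map_mul, map_zero, fa, hpre]
  have hcoe (z : FreeAlgebra ℂ (PGen I)) : RingQuot.mkRingHom (PRel C sgn) z =
      RingQuot.mkAlgHom ℂ (PRel C sgn) z := by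
    rw [← RingQuot.mkAlgHom_coe ℂ]; rfl
  refine ⟨RingQuot.liftAlgHom ℂ ⟨f, hf⟩, fun i => ?_, fun i k => ?_⟩
  · refine Eq.trans (congrArg (RingQuot.liftAlgHom ℂ ⟨f, hf⟩) (hcoe _)) ?_
    rw [RingQuot.liftAlgHom_mkAlgHom_apply, fe]
  · refine Eq.trans (congrArg (RingQuot.liftAlgHom ℂ ⟨f, hf⟩) (hcoe _)) ?_
    rw [RingQuot.liftAlgHom_mkAlgHom_apply, fa]

end Relations

section Action

variable {C sgn : I → I → ℤ} {X : Type} [AddCommGroup X] [Module (PreprojAlg C sgn) X]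

theorem pe_smul_pe (i k : I) (x : X) :
    pe C sgn i • pe C sgn k • x = if i = k then pe C sgn i • x else 0 := by
  rw [smul_smul, pe_mul_pe]; split_ifs <;> simp

theorem pa_smul_pe (i k : I) (x : X) : pa C sgn i k • pe C sgn i • x = pa C sgn i k • x := by
  rw [smul_smul, pa_mul_pe]

theorem pe_smul_pa (i k : I) (x : X) : pe C sgn k • pa C sgn i k • x = pa C sgn i k • x := by
  rw [smul_smul, pe_mul_pa]

theorem pe_smul_of_ne {i k : I} (h : i ≠ k) {x : X} (hx : pe C sgn k • x = x) :
    pe C sgn i • x = 0 := by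
  rw [← hx, pe_smul_pe, if_neg h]

theorem pa_smul_of_ne {i j : I} (h : i ≠ j) (k : I) {x : X} (hx : pe C sgn j • x = x) :
    pa C sgn i k • x = 0 := by
  rw [← pa_smul_pe, pe_smul_of_ne h hx, smul_zero]

theorem sum_pa_smul_pa (i : I) (x : X) :
    ∑ k, sgn k i • pa C sgn k i • pa C sgn i k • x = 0 := by
  have h := congrArg (· • x) (sum_pa_mul_pa C sgn i)
  simpa only [Finset.sum_smul, smul_assoc, mul_smul, zero_smul] using h

theorem mem_range_smulIdem [Module ℂ X] [SMulCommClass (PreprojAlg C sgn) ℂ X] (i : I) (x : X) :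
    x ∈ LinearMap.range (smulIdem C sgn X i) ↔ pe C sgn i • x = x := by
  constructor
  · rintro ⟨y, rfl⟩
    change pe C sgn i • pe C sgn i • y = pe C sgn i • y
    rw [pe_smul_pe, if_pos rfl]
  · intro h
    exact ⟨x, h⟩

/-- Arrows annihilate a module supported at a single vertex without loop. -/
theorem pa_smul_eq_zero_of_support (hdiag : ∀ i, C i i = 2) {j : I}
    (hX : ∀ x : X, pe C sgn j • x = x) (i k : I) (x : X) : pa C sgn i k • x = 0 := by
  by_cases hi : i = j
  · subst hi
    by_cases hk : k = i
    · subst hk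
      rw [pa_eq_zero C sgn (by rw [hdiag]; decide), zero_smul]
    · rw [← pe_smul_pa]
      exact pe_smul_of_ne hk (hX _)
  · exact pa_smul_of_ne hi k (hX x)

end Action

section Modules

variable {C sgn : I → I → ℤ}
variable {X Y : Type} [AddCommGroup X] [Module (PreprojAlg C sgn) X] [Module ℂ X]
  [IsScalarTower ℂ (PreprojAlg C sgn) X]
  [AddCommGroup Y] [Module (PreprojAlg C sgn) Y] [Module ℂ Y]
  [IsScalarTower ℂ (PreprojAlg C sgn) Y]

/-- A `ℂ`-linear map commuting with the idempotents and the arrows is `Λ`-linear. -/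
theorem map_smul_of_generators (f : X →ₗ[ℂ] Y)
    (he : ∀ i x, f (pe C sgn i • x) = pe C sgn i • f x)
    (ha : ∀ i k x, f (pa C sgn i k • x) = pa C sgn i k • f x)
    (l : PreprojAlg C sgn) (x : X) : f (l • x) = l • f x := by
  induction l using preprojAlg_induction generalizing x with
  | hc c => simp
  | he i => exact he i x
  | ha i k => exact ha i k x
  | hadd a b ha hb => simp [add_smul, ha, hb]
  | hmul a b ha hb => simp [mul_smul, ha, hb]

/-- A `ℂ`-linear map commuting with the idempotents and the arrows, as a `Λ`-linear map. -/
def linearMapOfGenerators (f : X →ₗ[ℂ] Y)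
    (he : ∀ i x, f (pe C sgn i • x) = pe C sgn i • f x)
    (ha : ∀ i k x, f (pa C sgn i k • x) = pa C sgn i k • f x) : X →ₗ[PreprojAlg C sgn] Y where
  toFun := f
  map_add' := f.map_add
  map_smul' := map_smul_of_generators f he ha

theorem finiteDimensional_hom [SMulCommClass (PreprojAlg C sgn) ℂ Y]
    [FiniteDimensional ℂ X] [FiniteDimensional ℂ Y] :
    FiniteDimensional ℂ (X →ₗ[PreprojAlg C sgn] Y) :=
  Module.Finite.of_injective (LinearMap.restrictScalarsₗ ℂ (PreprojAlg C sgn) X Y ℂ)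
    (LinearMap.restrictScalars_injective ℂ)

end Modules

section Neighbours

variable (C sgn : I → I → ℤ) (j : I)
variable (T : Type) [AddCommGroup T] [Module (PreprojAlg C sgn) T] [Module ℂ T]
  [SMulCommClass (PreprojAlg C sgn) ℂ T]

/-- `e_k T` if `k` is a neighbour of `j`, and `0` otherwise. -/
def nbr (k : I) : Submodule ℂ T :=
  if C j k = -1 then LinearMap.range (smulIdem C sgn T k) else ⊥

variable {T} in
theorem mem_nbr (k : I) (x : T) :
    x ∈ nbr C sgn j T k ↔ pe C sgn k • x = x ∧ (C j k ≠ -1 → x = 0) := by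
  unfold nbr
  split_ifs with h
  · rw [mem_range_smulIdem]
    exact ⟨fun hx => ⟨hx, fun hne => absurd h hne⟩, fun hx => hx.1⟩
  · simp only [Submodule.mem_bot, ne_eq, h, not_false_eq_true, forall_const]
    exact ⟨fun hx => ⟨by rw [hx, smul_zero], hx⟩, fun hx => hx.2⟩

variable {T} in
theorem pa_smul_mem_nbr (k : I) (x : T) : pa C sgn j k • x ∈ nbr C sgn j T k :=
  (mem_nbr C sgn j k _).2
    ⟨pe_smul_pa j k x, fun h => by rw [pa_eq_zero C sgn h, zero_smul]⟩

/-- The incoming map `⨁_{k ∼ j} e_k T → T` at the vertex `j`, with image in `e_j T`. -/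
def incoming : ((k : I) → nbr C sgn j T k) →ₗ[ℂ] T where
  toFun t := ∑ k, sgn k j • pa C sgn k j • (t k : T)
  map_add' t u := by simp [Finset.sum_add_distrib]
  map_smul' c t := by
    rw [RingHom.id_apply, Finset.smul_sum]
    refine Finset.sum_congr rfl fun k _ => ?_
    rw [Pi.smul_apply, Submodule.coe_smul, smul_comm (pa C sgn k j) c, smul_comm (sgn k j) c]

variable {T} in
theorem incoming_apply (t : (k : I) → nbr C sgn j T k) :
    incoming C sgn j T t = ∑ k, sgn k j • pa C sgn k j • (t k : T) := rfl

variable {C sgn j T} in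
theorem pa_smul_mem_range_incoming (hsym : ∀ i j, C i j = C j i)
    (hsgn : ∀ i j, C i j = -1 → sgn i j * sgn j i = -1 ∧ (sgn i j = 1 ∨ sgn i j = -1))
    (i : I) (x : T) : pa C sgn i j • x ∈ LinearMap.range (incoming C sgn j T) := by
  by_cases hij : C i j = -1
  · have hx : pe C sgn i • x ∈ nbr C sgn j T i :=
      (mem_nbr C sgn j i _).2
        ⟨by rw [pe_smul_pe, if_pos rfl], fun h => absurd ((hsym j i).trans hij) h⟩
    have key : incoming C sgn j T (Pi.single i ⟨_, hx⟩) = sgn i j • pa C sgn i j • x := by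
      rw [incoming_apply, Finset.sum_eq_single i]
      · rw [Pi.single_eq_same, pa_smul_pe]
      · intro k _ hk
        rw [Pi.single_eq_of_ne hk]
        simp
      · simp
    have hmem : sgn i j • pa C sgn i j • x ∈ LinearMap.range (incoming C sgn j T) :=
      ⟨_, key⟩
    rcases (hsgn i j hij).2 with h | h
    · simpa [h] using hmem
    · simpa [h] using hmem
  · rw [pa_eq_zero C sgn hij, zero_smul]
    exact zero_mem _

theorem finrank_nbr_pi [FiniteDimensional ℂ T] (hdiag : ∀ i, C i i = 2)
    (hoff : ∀ i j, i ≠ j → C i j = 0 ∨ C i j = -1) :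
    (finrank ℂ ((k : I) → nbr C sgn j T k) : ℤ) =
      2 * dimv C sgn T j - ∑ k, C j k * (dimv C sgn T k : ℤ) := by
  have h (k : I) : (finrank ℂ (nbr C sgn j T k) : ℤ) =
      (if k = j then 2 * (dimv C sgn T j : ℤ) else 0) - C j k * (dimv C sgn T k : ℤ) := by
    by_cases hk : k = j
    · subst hk
      have hn : nbr C sgn k T k = ⊥ := if_neg (by rw [hdiag]; decide)
      rw [hn, hdiag]
      simp
    · rw [if_neg hk]
      rcases hoff j k (Ne.symm hk) with h0 | h1
      · have hn : nbr C sgn j T k = ⊥ := if_neg (by rw [h0]; decide)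
        rw [hn, h0]
        simp
      · have hn : nbr C sgn j T k = LinearMap.range (smulIdem C sgn T k) := if_pos h1
        rw [hn, h1, dimv]
        ring
  rw [Module.finrank_pi_fintype]
  push_cast
  rw [Finset.sum_congr rfl fun k _ => h k, Finset.sum_sub_distrib]
  simp

end Neighbours

section Top

variable {C sgn : I → I → ℤ} {j : I}
variable {T : Type} [AddCommGroup T] [Module (PreprojAlg C sgn) T] [Module ℂ T]
  [SMulCommClass (PreprojAlg C sgn) ℂ T] [IsScalarTower ℂ (PreprojAlg C sgn) T]
variable {S : Type} [AddCommGroup S] [Module (PreprojAlg C sgn) S] [Module ℂ S]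
  [SMulCommClass (PreprojAlg C sgn) ℂ S] [IsScalarTower ℂ (PreprojAlg C sgn) S]

/-- `dim Hom_Λ(T, S_j)` is the codimension in `e_j T` of the image of the incoming map. -/
theorem finrank_hom_simple_add_finrank_range_incoming [FiniteDimensional ℂ T]
    (hsym : ∀ i j, C i j = C j i) (hdiag : ∀ i, C i i = 2)
    (hsgn : ∀ i j, C i j = -1 → sgn i j * sgn j i = -1 ∧ (sgn i j = 1 ∨ sgn i j = -1))
    (σ : S ≃ₗ[ℂ] ℂ) (hSj : ∀ x : S, pe C sgn j • x = x) :
    finrank ℂ (T →ₗ[PreprojAlg C sgn] S) + finrank ℂ (LinearMap.range (incoming C sgn j T)) =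
      dimv C sgn T j := by
  set R := LinearMap.range (incoming C sgn j T) with hR
  set K := LinearMap.ker (smulIdem C sgn T j) with hK
  have hRj : ∀ x ∈ R, pe C sgn j • x = x := by
    rintro x ⟨t, rfl⟩
    rw [incoming_apply, Finset.smul_sum]
    exact Finset.sum_congr rfl fun k _ => by rw [smul_comm, pe_smul_pa]
  have hmemK (x : T) : x ∈ K ↔ pe C sgn j • x = 0 := Iff.rfl
  have hdisj : R ⊓ K = ⊥ := by
    rw [eq_bot_iff]
    rintro x ⟨hxR, hxK⟩
    rw [Submodule.mem_bot, ← hRj x hxR]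
    exact hxK
  have hpaU (i k : I) (x : T) : pa C sgn i k • x ∈ R ⊔ K := by
    by_cases hk : k = j
    · subst hk
      exact Submodule.mem_sup_left (pa_smul_mem_range_incoming hsym hsgn i x)
    · refine Submodule.mem_sup_right ((hmemK _).2 ?_)
      exact pe_smul_of_ne (Ne.symm hk) (pe_smul_pa i k x)
  have hpaS := pa_smul_eq_zero_of_support (C := C) (sgn := sgn) hdiag hSj
  let e : (T →ₗ[PreprojAlg C sgn] S) ≃ₗ[ℂ] (R ⊔ K).dualAnnihilator :=
    { toFun := fun f => ⟨σ.toLinearMap ∘ₗ f.restrictScalars ℂ, by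
        rw [Submodule.mem_dualAnnihilator]
        intro x hx
        obtain ⟨y, ⟨t, rfl⟩, z, hz, rfl⟩ := Submodule.mem_sup.1 hx
        have h1 : f (incoming C sgn j T t) = 0 := by
          rw [incoming_apply, map_sum]
          exact Finset.sum_eq_zero fun k _ => by rw [map_zsmul, map_smul, hpaS, smul_zero]
        have h2 : f z = 0 := by
          rw [← hSj (f z), ← map_smul, (hmemK z).1 hz, map_zero]
        simp [h1, h2]⟩
      map_add' := fun f g => by ext x; simp
      map_smul' := fun c f => by ext x; simp
      invFun := fun φ => linearMapOfGenerators (σ.symm.toLinearMap ∘ₗ φ.1)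
        (fun i x => by
          have hφ := (Submodule.mem_dualAnnihilator _).1 φ.2
          by_cases hi : i = j
          · subst hi
            rw [hSj]
            have h0 : φ.1 (pe C sgn i • x - x) = 0 :=
              hφ _ (Submodule.mem_sup_right ((hmemK _).2 (by
                rw [smul_sub, pe_smul_pe, if_pos rfl, sub_self])))
            rw [map_sub, sub_eq_zero] at h0
            simp [h0]
          · have h0 : φ.1 (pe C sgn i • x) = 0 :=
              hφ _ (Submodule.mem_sup_right ((hmemK _).2 (by
                rw [pe_smul_pe, if_neg (Ne.symm hi)])))
            rw [pe_smul_of_ne hi (hSj _)]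
            simp [h0])
        (fun i k x => by
          have hφ := (Submodule.mem_dualAnnihilator _).1 φ.2
          rw [hpaS]
          simp [hφ _ (hpaU i k x)])
      left_inv := fun f => by ext x; simp [linearMapOfGenerators]
      right_inv := fun φ => by ext x; simp [linearMapOfGenerators] }
  have h1 := e.finrank_eq
  have h2 := Subspace.finrank_add_finrank_dualAnnihilator_eq (R ⊔ K)
  have h3 := Submodule.finrank_sup_add_finrank_inf_eq R K
  rw [hdisj, finrank_bot] at h3
  have h4 := LinearMap.finrank_range_add_finrank_ker (smulIdem C sgn T j)
  rw [← hK] at h4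
  unfold dimv
  omega

end Top

section Extension

variable {C sgn : I → I → ℤ} {j : I}
variable {T : Type} [AddCommGroup T] [Module (PreprojAlg C sgn) T] [Module ℂ T]
  [SMulCommClass (PreprojAlg C sgn) ℂ T]

/-- An element of the kernel of the incoming map at `j` defines an extension of `S_j` by `T`,
with underlying vector space `T × ℂ`. -/
theorem exists_extension (t : (k : I) → nbr C sgn j T k) (ht : incoming C sgn j T t = 0) :
    ∃ ρ : PreprojAlg C sgn →ₐ[ℂ] End ℂ (T × ℂ),
      (∀ i x c, ρ (pe C sgn i) (x, c) = (pe C sgn i • x, if i = j then c else 0)) ∧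
      ∀ i k x c, ρ (pa C sgn i k) (x, c) =
        (pa C sgn i k • x + if i = j then c • (t k : T) else 0, 0) := by
  let e (i : I) : End ℂ (T × ℂ) :=
    { toFun := fun y => (pe C sgn i • y.1, if i = j then y.2 else 0)
      map_add' := fun y z => by ext <;> simp; split_ifs <;> simp
      map_smul' := fun c y => by ext <;> simp [smul_comm (pe C sgn i) c] }
  let a (i k : I) : End ℂ (T × ℂ) :=
    { toFun := fun y => (pa C sgn i k • y.1 + if i = j then y.2 • (t k : T) else 0, 0)
      map_add' := fun y z => by
        ext
        · simp only [Prod.fst_add, Prod.snd_add, smul_add]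
          split_ifs
          · rw [add_smul]; abel
          · abel
        · simp
      map_smul' := fun c y => by
        ext
        · simp only [Prod.smul_fst, Prod.smul_snd, smul_add, RingHom.id_apply, smul_eq_mul,
            smul_comm (pa C sgn i k) c]
          split_ifs
          · rw [mul_smul]
          · rw [smul_zero]
        · simp }
  have e_apply (i : I) (x : T) (c : ℂ) :
      e i (x, c) = (pe C sgn i • x, if i = j then c else 0) := rfl
  have a_apply (i k : I) (x : T) (c : ℂ) :
      a i k (x, c) = (pa C sgn i k • x + if i = j then c • (t k : T) else 0, 0) := rfl
  have htk (k : I) := (mem_nbr C sgn j k _).1 (t k).2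
  refine Exists.imp (fun ρ h => ⟨fun i x c => by rw [h.1, e_apply],
    fun i k x c => by rw [h.2, a_apply]⟩)
    (exists_algHom_preprojAlg C sgn e a ?_ ?_ ?_ ?_ ?_ ?_)
  · intro i k
    refine LinearMap.ext fun ⟨x, c⟩ => ?_
    rw [Module.End.mul_apply, e_apply, e_apply, pe_smul_pe]
    by_cases hik : i = k
    · subst hik
      rw [if_pos rfl, if_pos rfl, e_apply]
      split_ifs <;> rfl
    · rw [if_neg hik, if_neg hik]
      by_cases hi : i = j
      · rw [if_neg (show k ≠ j from fun h => hik (hi.trans h.symm))]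
        simp
      · simp [hi]
  · refine LinearMap.ext fun ⟨x, c⟩ => ?_
    rw [LinearMap.sum_apply]
    ext
    · rw [Prod.fst_sum]
      simp only [e_apply]
      rw [← Finset.sum_smul, sum_pe, one_smul]
      rfl
    · rw [Prod.snd_sum]
      simp [e_apply]
  · intro i k
    refine LinearMap.ext fun ⟨x, c⟩ => ?_
    rw [Module.End.mul_apply, e_apply, a_apply, a_apply, pa_smul_pe]
    split_ifs <;> rfl
  · intro i k
    refine LinearMap.ext fun ⟨x, c⟩ => ?_
    rw [Module.End.mul_apply, a_apply, e_apply, smul_add, pe_smul_pa]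
    split_ifs
    · rw [smul_comm, (htk k).1]
    · rw [smul_comm, (htk k).1]
    · simp
    · simp
  · intro i k hik
    refine LinearMap.ext fun ⟨x, c⟩ => ?_
    rw [a_apply, pa_eq_zero C sgn hik, zero_smul, zero_add]
    split_ifs with hi
    · subst hi
      rw [(htk k).2 hik, smul_zero]
      rfl
    · rfl
  · intro i
    refine LinearMap.ext fun ⟨x, c⟩ => ?_
    rw [LinearMap.sum_apply]
    have hterm (k : I) : (sgn k i • (a k i * a i k)) (x, c) =
        (sgn k i • pa C sgn k i • pa C sgn i k • x +
          if i = j then c • sgn k i • pa C sgn k i • (t k : T) else 0, 0) := by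
      rw [LinearMap.smul_apply, Module.End.mul_apply, a_apply, a_apply]
      ext
      · split_ifs <;>
        simp [smul_add, smul_comm (pa C sgn k i) c, smul_comm (sgn k i) c]
      · simp
    simp only [hterm]
    ext
    · rw [Prod.fst_sum]
      simp only
      rw [Finset.sum_add_distrib, sum_pa_smul_pa, zero_add]
      split_ifs with hi
      · subst hi
        rw [← Finset.smul_sum, ← incoming_apply, ht, smul_zero]
        rfl
      · simp
    · rw [Prod.snd_sum]
      simp

end Extension

section Presentation

variable {C sgn : I → I → ℤ} {j : I}
variable {T : Type} [AddCommGroup T] [Module (PreprojAlg C sgn) T] [Module ℂ T]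
  [SMulCommClass (PreprojAlg C sgn) ℂ T] [IsScalarTower ℂ (PreprojAlg C sgn) T]
  [FiniteDimensional ℂ T]
variable {S : Type} [AddCommGroup S] [Module (PreprojAlg C sgn) S] [Module ℂ S]
  [IsScalarTower ℂ (PreprojAlg C sgn) S]
variable {P N : Type} [AddCommGroup P] [Module (PreprojAlg C sgn) P] [Module ℂ P]
  [SMulCommClass (PreprojAlg C sgn) ℂ P] [IsScalarTower ℂ (PreprojAlg C sgn) P]
  [FiniteDimensional ℂ P]
  [AddCommGroup N] [Module (PreprojAlg C sgn) N] [Module ℂ N]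
  [IsScalarTower ℂ (PreprojAlg C sgn) N] [FiniteDimensional ℂ N]

/-- For a projective presentation `0 → N → P → S_j → 0`, the exact sequence
`0 → Hom(P, T) → Hom(N, T) × e_j T → ker (⨁_{k ∼ j} e_k T → e_j T) → 0`, numerically. -/
theorem finrank_hom_add_finrank_ker_incoming (hdiag : ∀ i, C i i = 2)
    (σ : S ≃ₗ[ℂ] ℂ) (hSj : ∀ x : S, pe C sgn j • x = x)
    (π : P →ₗ[PreprojAlg C sgn] S) (hπ : Function.Surjective π)
    (hproj : Module.Projective (PreprojAlg C sgn) P)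
    (ι : N →ₗ[PreprojAlg C sgn] P) (hι : Function.Injective ι)
    (hex : LinearMap.range ι = LinearMap.ker π) :
    finrank ℂ (P →ₗ[PreprojAlg C sgn] T) + finrank ℂ (LinearMap.ker (incoming C sgn j T)) =
      finrank ℂ (N →ₗ[PreprojAlg C sgn] T) + dimv C sgn T j := by
  have hpaS := pa_smul_eq_zero_of_support (C := C) (sgn := sgn) hdiag hSj
  obtain ⟨p, hpj, hp⟩ : ∃ p : P, pe C sgn j • p = p ∧ σ (π p) = 1 := by
    obtain ⟨q, hq⟩ := hπ (σ.symm 1)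
    refine ⟨pe C sgn j • q, by rw [pe_smul_pe, if_pos rfl], ?_⟩
    rw [map_smul, hSj, hq, LinearEquiv.apply_symm_apply]
  have hπι (n : N) : π (ι n) = 0 := by
    have : ι n ∈ LinearMap.ker π := hex ▸ LinearMap.mem_range_self ι n
    exact this
  have hker (x : P) (hx : π x = 0) : ∃ n, ι n = x := by
    have : x ∈ LinearMap.range ι := hex ▸ LinearMap.mem_ker.2 hx
    exact this
  choose n hn using fun i k => hker (pa C sgn i k • p) (by rw [map_smul, hpaS])
  have hσπ (x : P) : π (x - σ (π x) • p) = 0 := by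
    apply σ.injective
    rw [map_sub, LinearMap.map_smul_of_tower, map_sub, map_smul, hp]
    simp
  choose r hr using fun x => hker _ (hσπ x)
  let rL : P →ₗ[ℂ] N :=
    { toFun := r
      map_add' := fun x y => hι (by rw [map_add, hr, hr, hr]; simp only [map_add, add_smul]; abel)
      map_smul' := fun c x => hι (by
        rw [RingHom.id_apply, LinearMap.map_smul_of_tower, hr, hr, LinearMap.map_smul_of_tower,
          map_smul, smul_eq_mul, mul_smul, smul_sub]) }
  have hdecomp (x : P) : x = ι (r x) + σ (π x) • p := by rw [hr, sub_add_cancel]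
  have hnk (k : I) : pe C sgn k • n j k = n j k :=
    hι (by rw [map_smul, hn, pe_smul_pa])
  have hn0 (k : I) (h : C j k ≠ -1) : n j k = 0 :=
    hι (by rw [hn, pa_eq_zero C sgn h, zero_smul, map_zero])
  have hnne (i k : I) (h : i ≠ j) : n i k = 0 :=
    hι (by rw [hn, pa_smul_of_ne h k hpj, map_zero])
  let E := LinearMap.range (smulIdem C sgn T j)
  let F : (P →ₗ[PreprojAlg C sgn] T) →ₗ[ℂ] (N →ₗ[PreprojAlg C sgn] T) × E :=
    { toFun := fun f => (f.comp ι, ⟨f p, (mem_range_smulIdem j _).2 (by rw [← map_smul, hpj])⟩)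
      map_add' := fun f g => by ext <;> simp
      map_smul' := fun c f => by ext <;> simp }
  let G : (N →ₗ[PreprojAlg C sgn] T) × E →ₗ[ℂ] ((k : I) → nbr C sgn j T k) :=
    { toFun := fun y k => ⟨y.1 (n j k) - pa C sgn j k • (y.2 : T),
        sub_mem ((mem_nbr C sgn j k _).2
          ⟨by rw [← map_smul, hnk], fun h => by rw [hn0 k h, map_zero]⟩)
          (pa_smul_mem_nbr C sgn j k _)⟩
      map_add' := fun y z => by
        ext k
        simp only [Prod.fst_add, Prod.snd_add, LinearMap.add_apply, Submodule.coe_add, smul_add,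
          Pi.add_apply]
        abel
      map_smul' := fun c y => by
        ext k
        simp [smul_sub, smul_comm (pa C sgn j k) c] }
  have hG (g : N →ₗ[PreprojAlg C sgn] T) (u : E) (k : I) :
      (G (g, u) k : T) = g (n j k) - pa C sgn j k • (u : T) := rfl
  have hFinj : Function.Injective F := by
    intro f g hfg
    have h1 : f.comp ι = g.comp ι := congrArg Prod.fst hfg
    have h2 : f p = g p := congrArg (fun y => (y.2 : T)) hfg
    refine LinearMap.ext fun x => ?_
    rw [hdecomp x, map_add, map_add, LinearMap.map_smul_of_tower, LinearMap.map_smul_of_tower, h2]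
    exact congrArg (· + _) (LinearMap.congr_fun h1 (r x))
  have hexact : LinearMap.range F = LinearMap.ker G := by
    apply le_antisymm
    · rintro _ ⟨f, rfl⟩
      rw [LinearMap.mem_ker]
      funext k
      apply Subtype.ext
      change f (ι (n j k)) - pa C sgn j k • f p = 0
      rw [hn, map_smul, sub_self]
    · rintro ⟨g, u⟩ hgu
      have huj := (mem_range_smulIdem j _).1 u.2
      have hgn (i k : I) : g (n i k) = pa C sgn i k • (u : T) := by
        by_cases hi : i = j
        · subst hi
          have := congrArg Subtype.val (congrFun (LinearMap.mem_ker.1 hgu) k)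
          rw [hG] at this
          exact sub_eq_zero.1 this
        · rw [hnne i k hi, map_zero, pa_smul_of_ne hi k huj]
      have hπe (i : I) (x : P) : σ (π (pe C sgn i • x)) = if i = j then σ (π x) else 0 := by
        rw [map_smul]
        split_ifs with hi
        · rw [hi, hSj]
        · rw [pe_smul_of_ne hi (hSj _), map_zero]
      have hre (i : I) (x : P) : r (pe C sgn i • x) = pe C sgn i • r x := hι (by
        rw [map_smul, hr, hr, hπe, smul_sub, smul_comm (pe C sgn i) (σ (π x))]
        split_ifs with hi
        · rw [hi, hpj]
        · rw [pe_smul_of_ne hi hpj, smul_zero, zero_smul])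
      have hra (i k : I) (x : P) :
          r (pa C sgn i k • x) = pa C sgn i k • r x + σ (π x) • n i k := hι (by
        rw [map_add, map_smul, LinearMap.map_smul_of_tower, hr, hr, hn, map_smul, hpaS, map_zero,
          zero_smul, smul_sub, smul_comm (pa C sgn i k) (σ (π x))]
        abel)
      let f : P →ₗ[ℂ] T := g.restrictScalars ℂ ∘ₗ rL +
        (σ.toLinearMap ∘ₗ π.restrictScalars ℂ).smulRight (u : T)
      have hf (x : P) : f x = g (r x) + σ (π x) • (u : T) := rfl
      refine ⟨linearMapOfGenerators f (fun i x => ?_) (fun i k x => ?_), ?_⟩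
      · rw [hf, hf, hre, hπe, map_smul, smul_add, smul_comm (pe C sgn i) (σ (π x))]
        split_ifs with hi
        · rw [hi, huj]
        · rw [pe_smul_of_ne hi huj, smul_zero, zero_smul]
      · rw [hf, hf, hra, map_smul, hpaS, map_zero, zero_smul, add_zero, map_add, map_smul,
          LinearMap.map_smul_of_tower, hgn, smul_add, smul_comm (pa C sgn i k) (σ (π x))]
      · have hrι (m : N) : r (ι m) = m := hι (by rw [hr, hπι, map_zero, zero_smul, sub_zero])
        have hrp : r p = 0 := hι (by rw [hr, hp, one_smul, sub_self, map_zero])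
        refine Prod.ext (LinearMap.ext fun m => ?_) (Subtype.ext ?_)
        · change f (ι m) = g m
          rw [hf, hrι, hπι, map_zero, zero_smul, add_zero]
        · change f p = u
          rw [hf, hrp, hp, map_zero, one_smul, zero_add]
  have hrange : LinearMap.range G = LinearMap.ker (incoming C sgn j T) := by
    apply le_antisymm
    · rintro _ ⟨⟨g, u⟩, rfl⟩
      rw [LinearMap.mem_ker, incoming_apply]
      have h0 : ∑ k, sgn k j • pa C sgn k j • n j k = 0 := hι (by
        rw [map_sum, map_zero, ← sum_pa_smul_pa (C := C) (sgn := sgn) j p]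
        exact Finset.sum_congr rfl fun k _ => by rw [map_zsmul, map_smul, hn])
      have h1 : ∑ k, sgn k j • pa C sgn k j • g (n j k) = 0 := by
        rw [← map_zero g, ← h0, map_sum]
        exact Finset.sum_congr rfl fun k _ => by rw [map_zsmul, map_smul]
      simp only [hG, smul_sub, Finset.sum_sub_distrib, h1, sum_pa_smul_pa, sub_self]
    · intro t ht
      obtain ⟨ρ, hρe, hρa⟩ := exists_extension t (LinearMap.mem_ker.1 ht)
      let _ : Module (PreprojAlg C sgn) (T × ℂ) := Module.compHom (T × ℂ) ρ.toRingHom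
      have hsmul (l : PreprojAlg C sgn) (y : T × ℂ) : l • y = ρ l y := rfl
      have : SMulCommClass (PreprojAlg C sgn) ℂ (T × ℂ) :=
        ⟨fun l c y => by rw [hsmul, hsmul, map_smul]⟩
      have : IsScalarTower ℂ (PreprojAlg C sgn) (T × ℂ) :=
        ⟨fun c l y => by rw [hsmul, hsmul, map_smul, LinearMap.smul_apply]⟩
      let q : T × ℂ →ₗ[PreprojAlg C sgn] S :=
        linearMapOfGenerators (σ.symm.toLinearMap ∘ₗ LinearMap.snd ℂ T ℂ)
          (fun i ⟨x, c⟩ => by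
            rw [hsmul, hρe]
            by_cases hi : i = j
            · subst hi
              simp [hSj]
            · rw [pe_smul_of_ne hi (hSj _)]
              simp [hi])
          (fun i k ⟨x, c⟩ => by
            rw [hsmul, hρa, hpaS]
            simp)
      have hq (y : T × ℂ) : q y = σ.symm y.2 := rfl
      obtain ⟨h, hh⟩ := Module.projective_lifting_property q π
        (fun s => ⟨(0, σ s), by rw [hq, LinearEquiv.symm_apply_apply]⟩)
      have hsnd (x : P) : (h x).2 = σ (π x) := by
        rw [← hh, LinearMap.comp_apply, hq, LinearEquiv.apply_symm_apply]
      let g : N →ₗ[PreprojAlg C sgn] T :=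
        linearMapOfGenerators
          (LinearMap.fst ℂ T ℂ ∘ₗ h.restrictScalars ℂ ∘ₗ ι.restrictScalars ℂ)
          (fun i x => by
            change (h (ι (pe C sgn i • x))).1 = pe C sgn i • (h (ι x)).1
            rw [map_smul, map_smul, hsmul, ← Prod.mk.eta (p := h (ι x)), hρe])
          (fun i k x => by
            change (h (ι (pa C sgn i k • x))).1 = pa C sgn i k • (h (ι x)).1
            have h0 : (h (ι x)).2 = 0 := by rw [hsnd, hπι, map_zero]
            rw [map_smul, map_smul, hsmul, ← Prod.mk.eta (p := h (ι x)), hρa, h0]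
            simp)
      have hu : pe C sgn j • (h p).1 = (h p).1 := by
        have := congrArg (fun x => (h x).1) hpj
        simp only [map_smul] at this
        rw [hsmul, ← Prod.mk.eta (p := h p), hρe] at this
        exact this
      refine ⟨(g, ⟨(h p).1, (mem_range_smulIdem j _).2 hu⟩), ?_⟩
      funext k
      apply Subtype.ext
      rw [hG]
      change (h (ι (n j k))).1 - pa C sgn j k • (h p).1 = t k
      rw [hn, map_smul, hsmul, ← Prod.mk.eta (p := h p), hρa, hsnd, hp]
      simp
  have : FiniteDimensional ℂ (P →ₗ[PreprojAlg C sgn] T) := finiteDimensional_hom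
  have : FiniteDimensional ℂ (N →ₗ[PreprojAlg C sgn] T) := finiteDimensional_hom
  have h1 := LinearMap.finrank_range_add_finrank_ker G
  rw [hrange, ← hexact, LinearMap.finrank_range_of_inj hFinj, Module.finrank_prod] at h1
  change _ = _ + finrank ℂ E
  omega

end Presentation

/-!
STATEMENT 12.  Let `P = P(M)` be an MV polytope for a simply-laced `g`, `Z = Pol⁻¹(P)`
the corresponding irreducible component of Lusztig's nilpotent variety, and `T` a general
point of `Z`.  By Baumann–Kamnitzer, `M_γ = −D_γ(Z) = −dim Hom_Λ(N(γ), T)` where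
`N(ϖ_j) = P_j` is the projective cover of `S_j`, and `N(s_jϖ_j)` is the kernel of the
cover map, i.e. there is a short exact sequence `0 → N(s_jϖ_j) → P_j → S_j → 0`.
By Kashiwara–Saito, `ε_j(Z) = dim top_j T = dim Hom_Λ(T, S_j)` and `wt(Z) = −dim T`, so
`φ_j(Z) = ε_j(Z) + ⟨h_j, wt(Z)⟩ = dim Hom_Λ(T,S_j) − ∑_k c_{jk} (dim T)_k`.
Claim: `c_j(P) = M_{ϖ_j} − M_{s_jϖ_j} − 1 = φ_j(Z) − 1`, i.e.
`−dim Hom(P_j,T) + dim Hom(N(s_jϖ_j),T) − 1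
   = dim Hom(T,S_j) − ∑_k c_{jk} (dim T)_k − 1`.
-/
theorem stmt_12 {I : Type} [Fintype I] [DecidableEq I]
    (C : I → I → ℤ) (sgn : I → I → ℤ)
    (hsym : ∀ i j, C i j = C j i) (hdiag : ∀ i, C i i = 2)
    (hoff : ∀ i j, i ≠ j → C i j = 0 ∨ C i j = -1)
    -- `C` is of Dynkin type, i.e. positive definite:
    (hpos : ∀ v : I → ℚ, v ≠ 0 → 0 < ∑ i, ∑ k, v i * v k * (C i k : ℚ))
    -- `sgn` comes from an orientation `Ω` of the graph:
    (hsgn : ∀ i j, C i j = -1 → sgn i j * sgn j i = -1 ∧ (sgn i j = 1 ∨ sgn i j = -1))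
    (j : I)
    -- `T`, a general point of the component `Z`
    (T : Type)
    [AddCommGroup T] [Module (PreprojAlg C sgn) T] [Module ℂ T]
    [SMulCommClass (PreprojAlg C sgn) ℂ T] [IsScalarTower ℂ (PreprojAlg C sgn) T]
    [FiniteDimensional ℂ T]
    -- `S` is the simple module `S_j` at the vertex `j`:
    (S : Type)
    [AddCommGroup S] [Module (PreprojAlg C sgn) S] [Module ℂ S]
    [SMulCommClass (PreprojAlg C sgn) ℂ S] [IsScalarTower ℂ (PreprojAlg C sgn) S]
    (hS1 : finrank ℂ S = 1) (hSj : ∀ x : S, pe C sgn j • x = x)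
    -- `Pj = N(ϖ_j)` is the projective cover of `S_j`, with kernel `N₁ = N(s_jϖ_j)`:
    (Pj N₁ : Type)
    [AddCommGroup Pj] [Module (PreprojAlg C sgn) Pj] [Module ℂ Pj]
    [SMulCommClass (PreprojAlg C sgn) ℂ Pj] [IsScalarTower ℂ (PreprojAlg C sgn) Pj]
    [FiniteDimensional ℂ Pj]
    [AddCommGroup N₁] [Module (PreprojAlg C sgn) N₁] [Module ℂ N₁]
    [SMulCommClass (PreprojAlg C sgn) ℂ N₁] [IsScalarTower ℂ (PreprojAlg C sgn) N₁]
    [FiniteDimensional ℂ N₁]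
    (π : Pj →ₗ[PreprojAlg C sgn] S) (hπ : Function.Surjective π)
    (hproj : Module.Projective (PreprojAlg C sgn) Pj)
    -- the cover is essential (no proper submodule surjects onto S_j):
    (hcover : ∀ V : Submodule (PreprojAlg C sgn) Pj, V ≠ ⊤ → Submodule.map π V ≠ ⊤)
    (ι : N₁ →ₗ[PreprojAlg C sgn] Pj) (hι : Function.Injective ι)
    (hex : LinearMap.range ι = LinearMap.ker π) :
    -(finrank ℂ (Pj →ₗ[PreprojAlg C sgn] T) : ℤ) -
        (-(finrank ℂ (N₁ →ₗ[PreprojAlg C sgn] T) : ℤ)) - 1 =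
      ((finrank ℂ (T →ₗ[PreprojAlg C sgn] S) : ℤ) -
        ∑ k, C j k * (dimv C sgn T k : ℤ)) - 1 := by
  have : FiniteDimensional ℂ S := FiniteDimensional.of_finrank_pos (by omega)
  let σ : S ≃ₗ[ℂ] ℂ := LinearEquiv.ofFinrankEq S ℂ (by rw [hS1, finrank_self])
  have h1 := finrank_hom_add_finrank_ker_incoming (T := T) hdiag σ hSj π hπ hproj ι hι hex
  have h2 := finrank_hom_simple_add_finrank_range_incoming (T := T) hsym hdiag hsgn σ hSj
  have h3 := LinearMap.finrank_range_add_finrank_ker (incoming C sgn j T)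
  have h4 := finrank_nbr_pi C sgn j T hdiag hoff
  omega
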